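/- arXiv:1809.10987 — 2 statements merged into one kernel-verified Lean document; each statement's English description precedes it below -/
import Mathlib

section
/- Let Λ be a lattice in ℝ^n, let Q be a positive definite symmetric bilinear form on ℝ^n that is integral with respect to Λ, fix r ∈ ℝ^n, and let B ⊂ ℤ^n be a complete set of representatives of ℤ^n/q(Λ). Then the set S = {(φ^b(Θ))_{b∈B} ∈ ℝ^B : Θ a theta function for (Q, Q(·,r))}, where φ^b(Θ) = inf_{y∈ℝ^n}(Θ(y) − Θ_b(y)), is a convex polyhedron in ℝ^B: there exist finitely many linear functionals c_1,…,c_N on ℝ^B and reals d_1,…,d_N such that S = {t ∈ ℝ^B : c_i(t) ≥ d_i for all i = 1,…,N}. -/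
noncomputable section

/-- Standard inner product on ℝ^n. -/
def dotp {n : ℕ} (a x : Fin n → ℝ) : ℝ := ∑ i, a i * x i

/-- Λ is a (full-rank) lattice in ℝ^n. -/
def IsLattice {n : ℕ} (Λ : Set (Fin n → ℝ)) : Prop :=
  ∃ e : Module.Basis (Fin n) ℝ (Fin n → ℝ),
    Λ = {x | ∃ c : Fin n → ℤ, x = ∑ i, (c i : ℝ) • e i}

/-- Q is a symmetric bilinear form. -/
def IsSymmBilin {n : ℕ} (Q : (Fin n → ℝ) → (Fin n → ℝ) → ℝ) : Prop :=
  (∀ x, IsLinearMap ℝ (Q x)) ∧ ∀ x y, Q x y = Q y x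

/-- Quasi-periodicity condition for (Q, α). -/
def QuasiPeriodic {n : ℕ} (Λ : Set (Fin n → ℝ))
    (Q : (Fin n → ℝ) → (Fin n → ℝ) → ℝ) (α : (Fin n → ℝ) → ℝ)
    (Θ : (Fin n → ℝ) → ℝ) : Prop :=
  ∀ l ∈ Λ, ∀ x, Θ (x + l) = Θ x + Q l x + (1/2) * Q l l + α l

/-- Θ is regular: locally a max of finitely many affine functions with integral slopes. -/
def RegularFn {n : ℕ} (Θ : (Fin n → ℝ) → ℝ) : Prop :=
  ∀ x : Fin n → ℝ, ∃ U ∈ nhds x, ∃ (k : ℕ) (a : Fin (k+1) → Fin n → ℤ) (c : Fin (k+1) → ℝ),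
    ∀ y ∈ U, Θ y = Finset.univ.sup' Finset.univ_nonempty
      (fun i => dotp (fun j => (a i j : ℝ)) y + c i)

/-- A theta function for (Q, α): convex, regular, quasi-periodic. -/
def IsThetaFn {n : ℕ} (Λ : Set (Fin n → ℝ))
    (Q : (Fin n → ℝ) → (Fin n → ℝ) → ℝ) (α : (Fin n → ℝ) → ℝ)
    (Θ : (Fin n → ℝ) → ℝ) : Prop :=
  ConvexOn ℝ Set.univ Θ ∧ RegularFn Θ ∧ QuasiPeriodic Λ Q α Θ

/-- Q is integral with respect to Λ. -/
def IntegralWrt {n : ℕ} (Q : (Fin n → ℝ) → (Fin n → ℝ) → ℝ) (Λ : Set (Fin n → ℝ)) : Prop :=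
  ∀ l ∈ Λ, ∀ m : Fin n → ℤ, ∃ k : ℤ, Q l (fun i => (m i : ℝ)) = (k : ℝ)

/-- m lies in q(Λ): ⟨m,x⟩ = Q(λ,x) for some λ ∈ Λ and all x. -/
def InQLat {n : ℕ} (Λ : Set (Fin n → ℝ)) (Q : (Fin n → ℝ) → (Fin n → ℝ) → ℝ)
    (m : Fin n → ℝ) : Prop :=
  ∃ l ∈ Λ, ∀ x, dotp m x = Q l x

/-- The generator Θ_b (with v_b passed as `vb`). -/
def ThetaGen {n : ℕ} (Λ : Set (Fin n → ℝ)) (Q : (Fin n → ℝ) → (Fin n → ℝ) → ℝ)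
    (r vb : Fin n → ℝ) (b : Fin n → ℤ) (x : Fin n → ℝ) : ℝ :=
  sSup {t | ∃ l ∈ Λ, t = dotp (fun i => (b i : ℝ)) x + Q l x
      - (1/2) * Q (l + vb - r) (l + vb - r)}

/-- The Legendre transform of Θ. -/
def legendreT {n : ℕ} (Θ : (Fin n → ℝ) → ℝ) (a : Fin n → ℝ) : ℝ :=
  sSup {t | ∃ x, t = dotp a x - Θ x}

/-- The generator Θ_b, with v_b obtained from the duality map v. -/
def thetaGenOf {n : ℕ} (Λ : Set (Fin n → ℝ)) (Q : (Fin n → ℝ) → (Fin n → ℝ) → ℝ)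
    (r : Fin n → ℝ) (v : (Fin n → ℝ) → (Fin n → ℝ)) (b : Fin n → ℤ) :
    (Fin n → ℝ) → ℝ :=
  ThetaGen Λ Q r (v (fun i => (b i : ℝ))) b

/-- φ^b(Θ) = inf_y (Θ(y) − Θ_b(y)). -/
def phiB {n : ℕ} (Λ : Set (Fin n → ℝ)) (Q : (Fin n → ℝ) → (Fin n → ℝ) → ℝ)
    (r : Fin n → ℝ) (v : (Fin n → ℝ) → (Fin n → ℝ)) (b : Fin n → ℤ)
    (Θ : (Fin n → ℝ) → ℝ) : ℝ :=
  sInf {u | ∃ y, u = Θ y - thetaGenOf Λ Q r v b y}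

/-- The coordinate set S ⊂ ℝ^B of tuples (φ^b(Θ))_{b∈B} for theta functions Θ. -/
def thetaCoordSet {n : ℕ} (Λ : Set (Fin n → ℝ)) (Q : (Fin n → ℝ) → (Fin n → ℝ) → ℝ)
    (r : Fin n → ℝ) (v : (Fin n → ℝ) → (Fin n → ℝ)) (B : Finset (Fin n → ℤ)) :
    Set ({b // b ∈ B} → ℝ) :=
  {t | ∃ Θ, IsThetaFn Λ Q (fun x => Q x r) Θ ∧
      ∀ b : {b // b ∈ B}, t b = phiB Λ Q r v b.1 Θ}

/-- Ξ(x) = sup over a ∈ ℤ^n of (⟨a,x⟩ − ½ Q(v_a−r, v_a−r)). -/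
def XiFn {n : ℕ} (Q : (Fin n → ℝ) → (Fin n → ℝ) → ℝ) (v : (Fin n → ℝ) → (Fin n → ℝ))
    (r : Fin n → ℝ) (x : Fin n → ℝ) : ℝ :=
  sSup {t | ∃ a : Fin n → ℤ, t = dotp (fun i => (a i : ℝ)) x
      - (1/2) * Q (v (fun i => (a i : ℝ)) - r) (v (fun i => (a i : ℝ)) - r)}


/-- Finite intersections of closed half spaces. -/
def IsPolyh {V : Type} [AddCommGroup V] [Module ℝ V] (S : Set V) : Prop :=
  ∃ (ι : Type) (_ : Fintype ι) (c : ι → V →ₗ[ℝ] ℝ) (d : ι → ℝ), S = {t | ∀ i, d i ≤ c i t}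

theorem IsPolyh.iInter {V : Type} [AddCommGroup V] [Module ℝ V] {κ : Type} [Fintype κ]
    {S : κ → Set V} (h : ∀ k, IsPolyh (S k)) : IsPolyh {t | ∀ k, t ∈ S k} := by
  choose ι hι c d h using h
  refine ⟨Σ k, ι k, inferInstance, fun p => c p.1 p.2, fun p => d p.1 p.2, ?_⟩
  ext t
  simp only [h, Set.mem_ofPred_eq, Sigma.forall]

theorem exists_between_fin {α β : Type} [Fintype α] [Fintype β] (l : α → ℝ) (u : β → ℝ)
    (h : ∀ i j, l i ≤ u j) : ∃ s, (∀ i, l i ≤ s) ∧ ∀ j, s ≤ u j := by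
  rcases isEmpty_or_nonempty α with ha | ha
  · rcases isEmpty_or_nonempty β with hb | hb
    · exact ⟨0, fun i => (ha.false i).elim, fun i => (hb.false i).elim⟩
    · obtain ⟨j, hj⟩ := Finite.exists_min u
      exact ⟨u j, fun i => (ha.false i).elim, hj⟩
  · obtain ⟨i, hi⟩ := Finite.exists_max l
    exact ⟨l i, hi, fun j => h i j⟩

theorem IsPolyh.proj_one {V : Type} [AddCommGroup V] [Module ℝ V] {S : Set (V × ℝ)}
    (h : IsPolyh S) : IsPolyh {t | ∃ s : ℝ, (t, s) ∈ S} := by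
  classical
  obtain ⟨ι, hι, c, d, rfl⟩ := h
  let c' : ι → V →ₗ[ℝ] ℝ := fun i => (c i).comp (LinearMap.inl ℝ V ℝ)
  let e : ι → ℝ := fun i => c i (0, 1)
  have hc : ∀ i t s, c i (t, s) = c' i t + e i * s := by
    intro i t s
    have : ((t, s) : V × ℝ) = (t, 0) + s • (0, 1) := by simp
    rw [this, map_add, map_smul]
    simp [c', e, mul_comm]
  refine ⟨{i // e i = 0} ⊕ ({i // 0 < e i} × {j // e j < 0}), inferInstance,
    Sum.elim (fun i => c' i.1) (fun p => (e p.1.1)⁻¹ • c' p.1.1 - (e p.2.1)⁻¹ • c' p.2.1),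
    Sum.elim (fun i => d i.1) (fun p => (e p.1.1)⁻¹ * d p.1.1 - (e p.2.1)⁻¹ * d p.2.1), ?_⟩
  have key : ∀ t s i, (d i ≤ c' i t + e i * s) ↔
      ((e i = 0 → d i ≤ c' i t) ∧ (0 < e i → (e i)⁻¹ * (d i - c' i t) ≤ s) ∧
        (e i < 0 → s ≤ (e i)⁻¹ * (d i - c' i t))) := by
    intro t s i
    rcases lt_trichotomy (e i) 0 with h | h | h
    · have h1 : ¬ (0 < e i) := by linarith
      have h2 : e i ≠ 0 := by linarith
      simp only [h, h1, h2, false_imp_iff, true_and, true_imp_iff]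
      rw [inv_mul_eq_div, le_div_iff_of_neg h]
      constructor <;> intro <;> linarith
    · simp [h]
    · have h1 : ¬ (e i < 0) := by linarith
      have h2 : e i ≠ 0 := by linarith
      simp only [h, h1, h2, false_imp_iff, true_and, true_imp_iff, and_true]
      rw [inv_mul_eq_div, div_le_iff₀ h]
      constructor <;> intro <;> linarith
  ext t
  simp only [Set.mem_ofPred_eq, hc, key]
  constructor
  · rintro ⟨s, hs⟩ (i | ⟨i, j⟩)
    · exact (hs i.1).1 i.2
    · have h1 := (hs i.1).2.1 i.2
      have h2 := (hs j.1).2.2 j.2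
      simp
      linarith
  · intro h
    obtain ⟨s, h1, h2⟩ := exists_between_fin
      (fun i : {i // 0 < e i} => (e i.1)⁻¹ * (d i.1 - c' i.1 t))
      (fun i : {i // e i < 0} => (e i.1)⁻¹ * (d i.1 - c' i.1 t)) (by
        intro i j
        have := h (Sum.inr (i, j))
        simp at this
        linarith)
    exact ⟨s, fun i => ⟨fun hi => h (Sum.inl ⟨i, hi⟩), fun hi => h1 ⟨i, hi⟩, fun hi => h2 ⟨i, hi⟩⟩⟩

theorem polyh_proj (n : ℕ) : ∀ {V : Type} [AddCommGroup V] [Module ℝ V] {ι : Type} [Fintype ι]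
    (c : ι → V →ₗ[ℝ] ℝ) (e : ι → Fin n → ℝ) (d : ι → ℝ),
    IsPolyh {t | ∃ x : Fin n → ℝ, ∀ i, dotp (e i) x + d i ≤ c i t} := by
  induction n with
  | zero =>
    intro V _ _ ι _ c e d
    refine ⟨ι, inferInstance, c, d, ?_⟩
    ext t
    simp [dotp]
  | succ n ih =>
    intro V _ _ ι _ c e d
    have := (ih (V := V × ℝ) (fun i => (c i).comp (LinearMap.fst ℝ V ℝ)
      - e i 0 • LinearMap.snd ℝ V ℝ) (fun i j => e i j.succ) d).proj_one
    convert this using 1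
    ext t
    simp only [Set.mem_ofPred_eq]
    constructor
    · rintro ⟨x, hx⟩
      refine ⟨x 0, fun j => x j.succ, fun i => ?_⟩
      have := hx i
      simp only [dotp, Fin.sum_univ_succ] at this
      simp [dotp]
      linarith
    · rintro ⟨s, x, hx⟩
      refine ⟨Fin.cons s x, fun i => ?_⟩
      have := hx i
      simp [dotp] at this
      simp [dotp, Fin.sum_univ_succ]
      linarith

/-- Algebraic rules for `Q`. -/
structure QRules {n : ℕ} (Q : (Fin n → ℝ) → (Fin n → ℝ) → ℝ) : Prop where
  symm : ∀ x y, Q x y = Q y x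
  addr : ∀ x y z, Q x (y + z) = Q x y + Q x z
  subr : ∀ x y z, Q x (y - z) = Q x y - Q x z
  negr : ∀ x y, Q x (-y) = - Q x y
  smulr : ∀ (c : ℝ) x y, Q x (c • y) = c * Q x y
  addl : ∀ x y z, Q (y + z) x = Q y x + Q z x
  subl : ∀ x y z, Q (y - z) x = Q y x - Q z x
  negl : ∀ x y, Q (-y) x = - Q y x
  smull : ∀ (c : ℝ) x y, Q (c • y) x = c * Q y x
  suml : ∀ {ι : Type} (s : Finset ι) (f : ι → Fin n → ℝ) x, Q (∑ i ∈ s, f i) x = ∑ i ∈ s, Q (f i) x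
  expand : ∀ x z, Q x z = ∑ i, x i * Q (Pi.single i 1) z
  contr : ∀ x, Continuous (Q x)
  contd : ∀ w, Continuous (fun x => Q (x + w) (x + w))
  nonneg : ∀ x, 0 ≤ Q x x
  ext : ∀ x y, (∀ z, Q x z = Q y z) → x = y
  young : ∀ x y, Q x y ≤ (1/4) * Q x x + Q y y
  cs : ∀ x y, Q x y ^ 2 ≤ Q x x * Q y y

theorem mkQRules {n : ℕ} {Q : (Fin n → ℝ) → (Fin n → ℝ) → ℝ} (hQ : IsSymmBilin Q)
    (hpos : ∀ x : Fin n → ℝ, x ≠ 0 → 0 < Q x x) : QRules Q := by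
  obtain ⟨hl, symm⟩ := hQ
  have addr : ∀ x y z, Q x (y + z) = Q x y + Q x z := fun x => (hl x).map_add
  have smulr : ∀ (c : ℝ) x y, Q x (c • y) = c * Q x y := fun c x y => (hl x).map_smul c y
  have negr : ∀ x y, Q x (-y) = - Q x y := fun x => (hl x).map_neg
  have subr : ∀ x y z, Q x (y - z) = Q x y - Q x z := fun x => (hl x).map_sub
  have addl : ∀ x y z, Q (y + z) x = Q y x + Q z x := fun x y z => by
    rw [symm, addr, symm x, symm x]
  have smull : ∀ (c : ℝ) x y, Q (c • y) x = c * Q y x := fun c x y => by rw [symm, smulr, symm x]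
  have negl : ∀ x y, Q (-y) x = - Q y x := fun x y => by rw [symm, negr, symm x]
  have subl : ∀ x y z, Q (y - z) x = Q y x - Q z x := fun x y z => by
    rw [symm, subr, symm x, symm x]
  have suml : ∀ {ι : Type} (s : Finset ι) (f : ι → Fin n → ℝ) x,
      Q (∑ i ∈ s, f i) x = ∑ i ∈ s, Q (f i) x := by
    intro ι s f x
    rw [symm]
    have := map_sum ((hl x).mk' (Q x)) f s
    simp only [IsLinearMap.mk'_apply] at this
    rw [this]
    exact Finset.sum_congr rfl fun i _ => symm _ _
  have expand : ∀ x z, Q x z = ∑ i, x i * Q (Pi.single i 1) z := by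
    intro x z
    have h : x = ∑ i, x i • (Pi.single i 1 : Fin n → ℝ) := by
      ext j
      simp [Finset.sum_apply, Pi.single_apply]
    conv_lhs => rw [h]
    rw [suml]
    exact Finset.sum_congr rfl fun i _ => smull _ _ _
  have contr : ∀ x, Continuous (Q x) := fun x =>
    LinearMap.continuous_of_finiteDimensional ((hl x).mk' (Q x))
  have nonneg : ∀ x, 0 ≤ Q x x := by
    intro x
    by_cases h : x = 0
    · subst h
      have := smulr 0 0 0
      simp at this
      rw [this]
    · exact (hpos x h).le
  have young : ∀ x y, Q x y ≤ (1/4) * Q x x + Q y y := by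
    intro x y
    have := nonneg ((1/2 : ℝ) • x - y)
    simp only [subl, subr, smull, smulr, symm y x] at this
    linarith
  refine ⟨symm, addr, subr, negr, smulr, addl, subl, negl, smull, suml, expand, contr, ?_, nonneg, ?_,
    young, ?_⟩
  · intro w
    have h : ∀ x, Q (x + w) (x + w) = ∑ i, (x + w) i * Q (Pi.single i 1) (x + w) :=
      fun x => expand _ _
    simp only [h]
    refine continuous_finsetSum _ fun i _ => ?_
    have := contr (Pi.single i 1)
    fun_prop
  · intro x y h
    by_contra hne
    have := hpos (x - y) (sub_ne_zero.2 hne)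
    rw [subl, h, sub_self] at this
    exact lt_irrefl _ this
  · intro x y
    by_cases h : Q y y = 0
    · have h0 : y = 0 := by
        by_contra hne
        exact (hpos y hne).ne' h
      subst h0
      have := smulr 0 x 0
      simp at this
      rw [this, h]; simp
    · have hp : 0 < Q y y := lt_of_le_of_ne (nonneg y) (Ne.symm h)
      have := nonneg (Q y y • x - Q x y • y)
      simp only [subl, subr, smull, smulr, symm y x] at this
      nlinarith

/-- The real vector of an integral vector. -/
abbrev ic {n : ℕ} (a : Fin n → ℤ) : Fin n → ℝ := fun i => (a i : ℝ)

theorem dotp_single {n : ℕ} (a : Fin n → ℝ) (i : Fin n) : dotp a (Pi.single i 1) = a i := by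
  simp [dotp, Pi.single_apply]

theorem v_unique {n : ℕ} {Q : (Fin n → ℝ) → (Fin n → ℝ) → ℝ} (hR : QRules Q)
    {v : (Fin n → ℝ) → (Fin n → ℝ)} (hv : ∀ a x, Q (v a) x = dotp a x)
    (m l : Fin n → ℝ) (h : ∀ x, dotp m x = Q l x) : v m = l :=
  hR.ext _ _ fun z => by rw [hv, h]

theorem v_sub {n : ℕ} {Q : (Fin n → ℝ) → (Fin n → ℝ) → ℝ} (hR : QRules Q)
    {v : (Fin n → ℝ) → (Fin n → ℝ)} (hv : ∀ a x, Q (v a) x = dotp a x)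
    (a b : Fin n → ℝ) : v (a - b) = v a - v b :=
  v_unique hR hv _ _ fun z => by
    rw [hR.subl, hv, hv]; simp [dotp, sub_mul]

theorem ic_sub {n : ℕ} (a b : Fin n → ℤ) : ic (a - b) = ic a - ic b := by
  ext i; simp [ic]

theorem finite_small {n : ℕ} {Q : (Fin n → ℝ) → (Fin n → ℝ) → ℝ} (hR : QRules Q)
    {v : (Fin n → ℝ) → (Fin n → ℝ)} (hv : ∀ a x, Q (v a) x = dotp a x) (K : ℝ) :
    {a : Fin n → ℤ | Q (v (ic a)) (v (ic a)) ≤ K}.Finite := by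
  let M : Fin n → ℤ := fun i => ⌊K * Q (Pi.single i 1) (Pi.single i 1)⌋
  refine (Set.finite_Icc (-M) M).subset ?_
  intro a ha
  have ha : Q (v (ic a)) (v (ic a)) ≤ K := ha
  have h : ∀ i, (a i) ^ 2 ≤ M i := by
    intro i
    apply Int.le_floor.2
    have h1 := hR.cs (v (ic a)) (Pi.single i 1)
    rw [hv, dotp_single] at h1
    push_cast
    exact h1.trans (mul_le_mul_of_nonneg_right ha (hR.nonneg _))
  refine ⟨fun i => ?_, fun i => ?_⟩
  · have := h i
    have h2 := Int.le_self_sq (-(a i))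
    simp only [Pi.neg_apply]
    nlinarith
  · exact (Int.le_self_sq _).trans (h i)

theorem lat_zero {n : ℕ} {Λ : Set (Fin n → ℝ)} (hΛ : IsLattice Λ) : 0 ∈ Λ := by
  obtain ⟨e, rfl⟩ := hΛ
  exact ⟨0, by simp⟩

theorem lat_sub {n : ℕ} {Λ : Set (Fin n → ℝ)} (hΛ : IsLattice Λ) {x y} (hx : x ∈ Λ) (hy : y ∈ Λ) :
    x - y ∈ Λ := by
  obtain ⟨e, rfl⟩ := hΛ
  obtain ⟨c, rfl⟩ := hx
  obtain ⟨d, rfl⟩ := hy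
  exact ⟨c - d, by simp [sub_smul]⟩

theorem lat_neg {n : ℕ} {Λ : Set (Fin n → ℝ)} (hΛ : IsLattice Λ) {x} (hx : x ∈ Λ) :
    -x ∈ Λ := by
  simpa using lat_sub hΛ (lat_zero hΛ) hx

theorem lat_add {n : ℕ} {Λ : Set (Fin n → ℝ)} (hΛ : IsLattice Λ) {x y} (hx : x ∈ Λ) (hy : y ∈ Λ) :
    x + y ∈ Λ := by
  simpa using lat_sub hΛ hx (lat_neg hΛ hy)

theorem q_int {n : ℕ} {Λ : Set (Fin n → ℝ)} {Q : (Fin n → ℝ) → (Fin n → ℝ) → ℝ} (hR : QRules Q)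
    (hint : IntegralWrt Q Λ) {v : (Fin n → ℝ) → (Fin n → ℝ)} (hv : ∀ a x, Q (v a) x = dotp a x)
    {l : Fin n → ℝ} (hl : l ∈ Λ) : ∃ m : Fin n → ℤ, v (ic m) = l := by
  choose m hm using fun i : Fin n => hint l hl (Pi.single i 1)
  refine ⟨m, v_unique hR hv _ _ fun x => ?_⟩
  rw [hR.symm, hR.expand]
  refine Finset.sum_congr rfl fun i _ => ?_
  have : (fun j => ((Pi.single i 1 : Fin n → ℤ) j : ℝ)) = Pi.single i 1 := by
    ext j
    by_cases h : j = i
    · subst h; simp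
    · simp [h]
  have h2 := hm i
  rw [this] at h2
  rw [hR.symm, h2, mul_comm]

theorem exists_cls {n : ℕ} {Λ : Set (Fin n → ℝ)} (hΛ : IsLattice Λ)
    {Q : (Fin n → ℝ) → (Fin n → ℝ) → ℝ} (hR : QRules Q)
    {v : (Fin n → ℝ) → (Fin n → ℝ)} (hv : ∀ a x, Q (v a) x = dotp a x)
    (B : Finset (Fin n → ℤ))
    (hB : ∀ m : Fin n → ℤ, ∃! b, b ∈ B ∧
      InQLat Λ Q (fun i => (m i : ℝ) - (b i : ℝ))) :
    ∃ cls : (Fin n → ℤ) → {b // b ∈ B}, (∀ b : {b // b ∈ B}, cls b.1 = b) ∧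
      (∀ a a', v (ic a) - v (ic a') ∈ Λ → cls a = cls a') ∧
      (∀ a, v (ic a) - v (ic (cls a).1) ∈ Λ) := by
  have key : ∀ m b : Fin n → ℤ, InQLat Λ Q (fun i => (m i : ℝ) - (b i : ℝ)) ↔
      v (ic m) - v (ic b) ∈ Λ := by
    intro m b
    have e : (fun i => (m i : ℝ) - (b i : ℝ)) = ic m - ic b := rfl
    rw [e, ← v_sub hR hv]
    constructor
    · rintro ⟨l, hl, h⟩
      rwa [v_unique hR hv _ l h]
    · intro h
      exact ⟨_, h, fun x => (hv _ x).symm⟩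
  simp only [key] at hB
  choose f hf hu using hB
  refine ⟨fun a => ⟨f a, (hf a).1⟩, ?_, ?_, fun a => (hf a).2⟩
  · intro b
    apply Subtype.ext
    refine (hu b.1 b.1 ⟨b.2, ?_⟩).symm
    rw [sub_self]; exact lat_zero hΛ
  · intro a a' h
    apply Subtype.ext
    refine hu a' (f a) ⟨(hf a).1, ?_⟩
    have := lat_sub hΛ (hf a).2 h
    convert this using 1
    abel

theorem phi_key {n : ℕ} {Λ : Set (Fin n → ℝ)}
    {Q : (Fin n → ℝ) → (Fin n → ℝ) → ℝ} (hR : QRules Q) {r : Fin n → ℝ}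
    {v : (Fin n → ℝ) → (Fin n → ℝ)} (hv : ∀ a x, Q (v a) x = dotp a x)
    {Θ : (Fin n → ℝ) → ℝ} (hΘ : QuasiPeriodic Λ Q (fun x => Q x r) Θ) (b : Fin n → ℝ)
    {l : Fin n → ℝ} (hl : l ∈ Λ) (y : Fin n → ℝ) :
    Θ y - (dotp b y + Q l y - (1/2) * Q (l + v b - r) (l + v b - r)) =
      Θ (y - l) - dotp b (y - l) + (1/2) * Q (v b - r) (v b - r) := by
  have h := hΘ l hl (y - l)
  rw [sub_add_cancel] at h
  rw [h, ← hv, ← hv]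
  simp only [hR.subl, hR.subr, hR.addl, hR.addr]
  rw [hR.symm (v b) l, hR.symm r l, hR.symm r (v b)]
  ring

theorem phi_eq {n : ℕ} {Λ : Set (Fin n → ℝ)} (hΛ : IsLattice Λ)
    {Q : (Fin n → ℝ) → (Fin n → ℝ) → ℝ} (hR : QRules Q) {r : Fin n → ℝ}
    {v : (Fin n → ℝ) → (Fin n → ℝ)} (hv : ∀ a x, Q (v a) x = dotp a x)
    {Θ : (Fin n → ℝ) → ℝ} (hΘ : QuasiPeriodic Λ Q (fun x => Q x r) Θ) (b : Fin n → ℤ)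
    (xb : Fin n → ℝ) (hmin : ∀ x, Θ xb - dotp (ic b) xb ≤ Θ x - dotp (ic b) x) :
    phiB Λ Q r v b Θ = Θ xb - dotp (ic b) xb
      + (1/2) * Q (v (ic b) - r) (v (ic b) - r) := by
  have ub : ∀ y, ∀ t ∈ {t | ∃ l ∈ Λ, t = dotp (ic b) y + Q l y
      - (1/2) * Q (l + v (ic b) - r) (l + v (ic b) - r)}, t ≤ Θ y - (Θ xb - dotp (ic b) xb
      + (1/2) * Q (v (ic b) - r) (v (ic b) - r)) := by
    rintro y t ⟨l, hl, rfl⟩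
    have h1 := phi_key hR hv hΘ (ic b) hl y
    have h2 := hmin (y - l)
    linarith
  have ne : ∀ y, {t | ∃ l ∈ Λ, t = dotp (ic b) y + Q l y
      - (1/2) * Q (l + v (ic b) - r) (l + v (ic b) - r)}.Nonempty :=
    fun y => ⟨_, 0, lat_zero hΛ, rfl⟩
  have lb : ∀ u ∈ {u | ∃ y, u = Θ y - thetaGenOf Λ Q r v b y}, Θ xb - dotp (ic b) xb
      + (1/2) * Q (v (ic b) - r) (v (ic b) - r) ≤ u := by
    rintro u ⟨y, rfl⟩
    have : thetaGenOf Λ Q r v b y ≤ _ := csSup_le (ne y) (ub y)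
    linarith
  apply le_antisymm
  · have h1 : phiB Λ Q r v b Θ ≤ _ := csInf_le ⟨_, lb⟩ ⟨xb, rfl⟩
    have h2 : _ ≤ thetaGenOf Λ Q r v b xb := le_csSup ⟨_, ub xb⟩ ⟨0, lat_zero hΛ, rfl⟩
    have h3 := phi_key hR hv hΘ (ic b) (lat_zero hΛ) xb
    rw [sub_zero] at h3
    linarith
  · exact le_csInf ⟨_, xb, rfl⟩ lb

theorem qcontinuous_diag {n : ℕ} {Q : (Fin n → ℝ) → (Fin n → ℝ) → ℝ} (hR : QRules Q) :
    Continuous (fun x => Q x x) := by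
  simpa using hR.contd 0

theorem exists_min_theta {n : ℕ} {Λ : Set (Fin n → ℝ)} (hΛ : IsLattice Λ)
    {Q : (Fin n → ℝ) → (Fin n → ℝ) → ℝ} (hR : QRules Q) {r : Fin n → ℝ}
    {v : (Fin n → ℝ) → (Fin n → ℝ)} (hv : ∀ a x, Q (v a) x = dotp a x)
    {Θ : (Fin n → ℝ) → ℝ} (hc : Continuous Θ)
    (hΘ : QuasiPeriodic Λ Q (fun x => Q x r) Θ) (b : Fin n → ℝ) :
    ∃ xb, ∀ x, Θ xb - dotp b xb ≤ Θ x - dotp b x := by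
  -- the periodic part
  let h : (Fin n → ℝ) → ℝ := fun x => Θ x - (1/2) * Q x x - Q r x
  have hcont : Continuous h := by
    have h1 := qcontinuous_diag hR
    have h2 := hR.contr r
    exact (hc.sub (continuous_const.mul h1)).sub h2
  have hper : ∀ l ∈ Λ, ∀ x, h (x + l) = h x := by
    intro l hl x
    simp only [h, hΘ l hl x, hR.addl, hR.addr, hR.symm x l, hR.symm r l]
    ring
  obtain ⟨h0, hh0⟩ : ∃ h0, ∀ x, h0 ≤ h x := by
    obtain ⟨e, rfl⟩ := hΛ
    let K : Set (Fin n → ℝ) := (fun c : Fin n → ℝ => ∑ i, c i • e i) '' Set.Icc 0 1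
    have hK : IsCompact K := isCompact_Icc.image (by fun_prop)
    obtain ⟨h0, hh0⟩ := (hK.image hcont).bddBelow
    refine ⟨h0, fun x => ?_⟩
    have hx : x = (∑ i, Int.fract (e.repr x i) • e i)
        + ∑ i, ((⌊e.repr x i⌋ : ℤ) : ℝ) • e i := by
      rw [← Finset.sum_add_distrib]
      conv_lhs => rw [← e.sum_repr x]
      refine Finset.sum_congr rfl fun i _ => ?_
      rw [← add_smul, Int.fract_add_floor]
    rw [hx, hper _ ⟨_, rfl⟩]
    refine hh0 ⟨_, ⟨fun i => Int.fract (e.repr x i), ⟨fun i => Int.fract_nonneg _,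
      fun i => (Int.fract_lt_one _).le⟩, rfl⟩, rfl⟩
  let w := v b - r
  have hg : ∀ x, Θ x - dotp b x = h x + (1/2) * Q (x - w) (x - w) - (1/2) * Q w w := by
    intro x
    have : dotp b x = Q (w + r) x := by simp [w, hv]
    rw [this]
    simp only [h, hR.addl, hR.subl, hR.subr, hR.symm x w]
    ring
  let M := 2 * (h w - h0)
  let K : Set (Fin n → ℝ) := {x | Q (x - w) (x - w) ≤ M}
  have hK : IsCompact K := by
    apply Metric.isCompact_of_isClosed_isBounded
    · apply isClosed_le _ continuous_const
      simpa [sub_eq_add_neg] using hR.contd (-w)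
    · let N : Fin n → ℝ := fun i => M * Q (v (Pi.single i 1)) (v (Pi.single i 1)) + 1
      refine (Metric.isBounded_Icc (w - N) (w + N)).subset ?_
      intro x hx
      have hx : Q (x - w) (x - w) ≤ M := hx
      have : ∀ i, |(x - w) i| ≤ N i := by
        intro i
        have h1 := hR.cs (x - w) (v (Pi.single i 1))
        have h3 : Q (x - w) (v (Pi.single i 1)) = (x - w) i := by
          rw [hR.symm, hv]; simp [dotp, Pi.single_apply]
        rw [h3] at h1
        have h2 := mul_le_mul_of_nonneg_right hx (hR.nonneg (v (Pi.single i 1)))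
        simp only [N]
        rw [abs_le]
        constructor <;> nlinarith
      refine ⟨fun i => ?_, fun i => ?_⟩
      · have := (abs_le.1 (this i)).1
        simp at this ⊢
        linarith
      · have := (abs_le.1 (this i)).2
        simp at this ⊢
        linarith
  have hwK : w ∈ K := by
    have : Q (w - w) (w - w) = 0 := by simp only [hR.subl]; ring
    change Q (w - w) (w - w) ≤ M
    rw [this]
    have := hh0 w
    simp only [M]; linarith
  have hgc : Continuous (fun x => Θ x - dotp b x) := by
    have := hR.contr (v b)
    simp only [← hv]
    fun_prop
  obtain ⟨xb, -, hmin⟩ := hK.exists_isMinOn ⟨w, hwK⟩ hgc.continuousOn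
  refine ⟨xb, fun x => ?_⟩
  by_cases hx : x ∈ K
  · exact hmin hx
  · refine (hmin hwK).trans ?_
    have hx : M < Q (x - w) (x - w) := not_le.1 hx
    have : Q (w - w) (w - w) = 0 := by simp only [hR.subl]; ring
    change Θ w - dotp b w ≤ _
    rw [hg, hg, this]
    have := hh0 x
    simp only [M] at hx
    linarith

/-- The affine inequalities that characterise membership. -/
def Good {n : ℕ} (Q : (Fin n → ℝ) → (Fin n → ℝ) → ℝ) (r : Fin n → ℝ)
    (v : (Fin n → ℝ) → (Fin n → ℝ)) {B : Finset (Fin n → ℤ)}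
    (cls : (Fin n → ℤ) → {b // b ∈ B}) (t : {b // b ∈ B} → ℝ) (b : {b // b ∈ B})
    (x : Fin n → ℝ) (a : Fin n → ℤ) : Prop :=
  dotp (ic a) x - ((1/2) * Q (v (ic a) - r) (v (ic a) - r) - t (cls a)) ≤
    dotp (ic b.1) x - ((1/2) * Q (v (ic b.1) - r) (v (ic b.1) - r) - t b)

theorem good_of_mem {n : ℕ} {Λ : Set (Fin n → ℝ)} (hΛ : IsLattice Λ)
    {Q : (Fin n → ℝ) → (Fin n → ℝ) → ℝ} (hR : QRules Q) {r : Fin n → ℝ}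
    {v : (Fin n → ℝ) → (Fin n → ℝ)} (hv : ∀ a x, Q (v a) x = dotp a x)
    {B : Finset (Fin n → ℤ)} (cls : (Fin n → ℤ) → {b // b ∈ B})
    (h3 : ∀ a, v (ic a) - v (ic (cls a).1) ∈ Λ)
    {t : {b // b ∈ B} → ℝ} (ht : t ∈ thetaCoordSet Λ Q r v B) (b : {b // b ∈ B}) :
    ∃ x, ∀ a, Good Q r v cls t b x a := by
  obtain ⟨Θ, ⟨hconv, -, hΘ⟩, ht⟩ := ht
  have hc : Continuous Θ := by
    have := hconv.continuousOn isOpen_univ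
    exact continuousOn_univ.1 this
  choose x hx using fun c : {b // b ∈ B} => exists_min_theta hΛ hR hv hc hΘ (ic c.1)
  have hphi : ∀ c : {b // b ∈ B}, t c = _ := fun c =>
    (ht c).trans (phi_eq hΛ hR hv hΘ c.1 (x c) (hx c))
  refine ⟨x b, fun a => ?_⟩
  unfold Good
  have e1 := hphi b
  have e2 := hphi (cls a)
  have e3 := phi_key hR hv hΘ (ic (cls a).1) (h3 a) (x b)
  have e4 := hx (cls a) (x b - (v (ic a) - v (ic (cls a).1)))
  rw [hR.subl, hv, hv, sub_add_cancel] at e3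
  linarith

theorem finite_large {n : ℕ} {Q : (Fin n → ℝ) → (Fin n → ℝ) → ℝ} (hR : QRules Q) {r : Fin n → ℝ}
    {v : (Fin n → ℝ) → (Fin n → ℝ)} (hv : ∀ a x, Q (v a) x = dotp a x)
    {B : Finset (Fin n → ℤ)} (cls : (Fin n → ℤ) → {b // b ∈ B}) (t : {b // b ∈ B} → ℝ)
    (D c : ℝ) : {a : Fin n → ℤ | ∃ y, Q (y + r) (y + r) ≤ D ∧
      c ≤ dotp (ic a) y - ((1/2) * Q (v (ic a) - r) (v (ic a) - r) - t (cls a))}.Finite := by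
  obtain ⟨T, hT⟩ : ∃ T, ∀ b, t b ≤ T := by
    obtain ⟨T, hT⟩ := (Set.finite_range t).bddAbove
    exact ⟨T, fun b => hT ⟨b, rfl⟩⟩
  refine (finite_small hR hv (4 * (D + T - c))).subset ?_
  rintro a ⟨y, hy, ha⟩
  change Q (v (ic a)) (v (ic a)) ≤ _
  have h1 := hR.young (v (ic a)) (y + r)
  have h2 := hT (cls a)
  have h3 := hR.nonneg r
  rw [← hv] at ha
  simp only [hR.subl, hR.subr, hR.symm r (v (ic a))] at ha
  rw [hR.addr] at h1
  linarith

/-- The theta function with given coordinates. -/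
def thetaT {n : ℕ} (Q : (Fin n → ℝ) → (Fin n → ℝ) → ℝ) (r : Fin n → ℝ)
    (v : (Fin n → ℝ) → (Fin n → ℝ)) {B : Finset (Fin n → ℤ)}
    (cls : (Fin n → ℤ) → {b // b ∈ B}) (t : {b // b ∈ B} → ℝ) (x : Fin n → ℝ) : ℝ :=
  ⨆ a : Fin n → ℤ, (dotp (ic a) x - ((1/2) * Q (v (ic a) - r) (v (ic a) - r) - t (cls a)))

theorem thetaT_bdd {n : ℕ} {Q : (Fin n → ℝ) → (Fin n → ℝ) → ℝ} (hR : QRules Q) {r : Fin n → ℝ}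
    {v : (Fin n → ℝ) → (Fin n → ℝ)} (hv : ∀ a x, Q (v a) x = dotp a x)
    {B : Finset (Fin n → ℤ)} (cls : (Fin n → ℤ) → {b // b ∈ B}) (t : {b // b ∈ B} → ℝ)
    (x : Fin n → ℝ) : BddAbove (Set.range fun a : Fin n → ℤ =>
      (dotp (ic a) x - ((1/2) * Q (v (ic a) - r) (v (ic a) - r) - t (cls a)))) := by
  have hf := finite_large hR (r := r) hv cls t (Q (x + r) (x + r)) 0
  let g := fun a : Fin n → ℤ =>
      (dotp (ic a) x - ((1/2) * Q (v (ic a) - r) (v (ic a) - r) - t (cls a)))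
  obtain ⟨M, hM⟩ := (hf.image g).bddAbove
  refine ⟨max M 0, ?_⟩
  rintro _ ⟨a, rfl⟩
  by_cases h : 0 ≤ g a
  · exact le_max_of_le_left (hM ⟨a, ⟨x, le_rfl, h⟩, rfl⟩)
  · exact le_max_of_le_right (not_le.1 h).le

theorem thetaT_regular {n : ℕ} {Q : (Fin n → ℝ) → (Fin n → ℝ) → ℝ} (hR : QRules Q)
    {r : Fin n → ℝ}
    {v : (Fin n → ℝ) → (Fin n → ℝ)} (hv : ∀ a x, Q (v a) x = dotp a x)
    {B : Finset (Fin n → ℤ)} (cls : (Fin n → ℤ) → {b // b ∈ B}) (t : {b // b ∈ B} → ℝ) :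
    RegularFn (thetaT Q r v cls t) := by
  intro x
  let fa : (Fin n → ℤ) → ℝ := fun a => ((1/2) * Q (v (ic a) - r) (v (ic a) - r) - t (cls a))
  have hf := finite_large hR (r := r) hv cls t (Q (x + r) (x + r) + 1) (- fa 0)
  have h0 : ∀ y, dotp (ic (0 : Fin n → ℤ)) y - fa 0 = - fa 0 := by
    intro y; simp [dotp, ic]
  let U : Set (Fin n → ℝ) := {y | Q (y + r) (y + r) < Q (x + r) (x + r) + 1}
  have hU : U ∈ nhds x := by
    apply IsOpen.mem_nhds
    · exact isOpen_lt (hR.contd r) continuous_const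
    · change Q (x + r) (x + r) < Q (x + r) (x + r) + 1
      linarith
  let A := hf.toFinset
  have hA : ∀ a y, y ∈ U → - fa 0 ≤ dotp (ic a) y - fa a → a ∈ A := by
    intro a y hy h
    exact hf.mem_toFinset.2 ⟨y, le_of_lt hy, h⟩
  have h0A : (0 : Fin n → ℤ) ∈ A := hA 0 x (mem_of_mem_nhds hU) (h0 x).ge
  have hcard : A.card = (A.card - 1) + 1 :=
    (Nat.succ_pred_eq_of_pos (Finset.card_pos.2 ⟨0, h0A⟩)).symm
  let E := A.equivFinOfCardEq hcard
  refine ⟨U, hU, A.card - 1, fun i => (E.symm i).1, fun i => - fa (E.symm i).1, ?_⟩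
  intro y hy
  have hb := thetaT_bdd hR (r := r) hv cls t y
  apply le_antisymm
  · refine ciSup_le fun a => ?_
    by_cases h : - fa 0 ≤ dotp (ic a) y - fa a
    · have := Finset.le_sup' (f := fun i => dotp (fun j => (((E.symm i).1 j : ℤ) : ℝ)) y
        + - fa (E.symm i).1) (Finset.mem_univ (E ⟨a, hA a y hy h⟩))
      refine le_trans (le_of_eq ?_) this
      simp [fa, sub_eq_add_neg]
    · have := Finset.le_sup' (f := fun i => dotp (fun j => (((E.symm i).1 j : ℤ) : ℝ)) y
        + - fa (E.symm i).1) (Finset.mem_univ (E ⟨0, h0A⟩))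
      refine le_trans ?_ this
      simp only [Equiv.symm_apply_apply]
      have h2 := h0 y
      have h3 : dotp (ic a) y - fa a < - fa 0 := not_le.1 h
      have h4 : dotp (ic (0 : Fin n → ℤ)) y + - fa 0 = - fa 0 := by linarith
      exact h3.le.trans h4.ge
  · refine Finset.sup'_le _ _ fun i _ => ?_
    rw [← sub_eq_add_neg]
    exact le_ciSup hb (E.symm i).1

theorem thetaT_convex {n : ℕ} {Q : (Fin n → ℝ) → (Fin n → ℝ) → ℝ} (hR : QRules Q)
    {r : Fin n → ℝ}
    {v : (Fin n → ℝ) → (Fin n → ℝ)} (hv : ∀ a x, Q (v a) x = dotp a x)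
    {B : Finset (Fin n → ℤ)} (cls : (Fin n → ℤ) → {b // b ∈ B}) (t : {b // b ∈ B} → ℝ) :
    ConvexOn ℝ Set.univ (thetaT Q r v cls t) := by
  refine ⟨convex_univ, ?_⟩
  intro x _ y _ α β hα hβ hαβ
  refine ciSup_le fun a => ?_
  have hx := mul_le_mul_of_nonneg_left (le_ciSup (thetaT_bdd hR (r := r) hv cls t x) a) hα
  have hy := mul_le_mul_of_nonneg_left (le_ciSup (thetaT_bdd hR (r := r) hv cls t y) a) hβ
  refine le_trans (le_of_eq ?_) (add_le_add hx hy)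
  have : β = 1 - α := by linarith
  simp only [← hv, hR.addr, hR.smulr]
  subst this
  ring

theorem thetaT_quasi {n : ℕ} {Λ : Set (Fin n → ℝ)} (hΛ : IsLattice Λ)
    {Q : (Fin n → ℝ) → (Fin n → ℝ) → ℝ} (hR : QRules Q) (hint : IntegralWrt Q Λ)
    {r : Fin n → ℝ}
    {v : (Fin n → ℝ) → (Fin n → ℝ)} (hv : ∀ a x, Q (v a) x = dotp a x)
    {B : Finset (Fin n → ℤ)} (cls : (Fin n → ℤ) → {b // b ∈ B}) (t : {b // b ∈ B} → ℝ)
    (h2 : ∀ a a', v (ic a) - v (ic a') ∈ Λ → cls a = cls a') :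
    QuasiPeriodic Λ Q (fun x => Q x r) (thetaT Q r v cls t) := by
  have key : ∀ l ∈ Λ, ∀ x, thetaT Q r v cls t (x + l) ≤
      thetaT Q r v cls t x + Q l x + (1/2) * Q l l + Q l r := by
    intro l hl x
    refine ciSup_le fun a => ?_
    obtain ⟨m, hm⟩ := q_int hR hint hv hl
    have hva : v (ic (a - m)) = v (ic a) - l := by rw [ic_sub, v_sub hR hv, hm]
    have hcls : cls (a - m) = cls a := by
      apply h2
      rw [hva]
      simpa using lat_neg hΛ hl
    have h := le_ciSup (thetaT_bdd hR (r := r) hv cls t x) (a - m)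
    rw [hcls, ← hv, hva] at h
    change _ ≤ thetaT Q r v cls t x at h
    rw [← hv]
    simp only [hR.addr, hR.subl, hR.subr, hR.symm r (v (ic a)), hR.symm r l,
      hR.symm (v (ic a)) l] at h ⊢
    linarith
  intro l hl x
  apply le_antisymm (key l hl x)
  have := key (-l) (lat_neg hΛ hl) (x + l)
  simp only [add_neg_cancel_right, hR.negl, hR.negr, hR.addr] at this
  linarith

theorem mem_of_good {n : ℕ} {Λ : Set (Fin n → ℝ)} (hΛ : IsLattice Λ)
    {Q : (Fin n → ℝ) → (Fin n → ℝ) → ℝ} (hR : QRules Q) (hint : IntegralWrt Q Λ)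
    {r : Fin n → ℝ}
    {v : (Fin n → ℝ) → (Fin n → ℝ)} (hv : ∀ a x, Q (v a) x = dotp a x)
    {B : Finset (Fin n → ℤ)} (cls : (Fin n → ℤ) → {b // b ∈ B})
    (h1 : ∀ b : {b // b ∈ B}, cls b.1 = b)
    (h2 : ∀ a a', v (ic a) - v (ic a') ∈ Λ → cls a = cls a')
    {t : {b // b ∈ B} → ℝ} (hg : ∀ b, ∃ x, ∀ a, Good Q r v cls t b x a) :
    t ∈ thetaCoordSet Λ Q r v B := by
  have hq := thetaT_quasi hΛ hR hint (r := r) hv cls t h2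
  refine ⟨thetaT Q r v cls t, ⟨thetaT_convex hR hv cls t, thetaT_regular hR hv cls t, hq⟩, ?_⟩
  intro b
  obtain ⟨x, hx⟩ := hg b
  have hle : ∀ y, dotp (ic b.1) y - ((1/2) * Q (v (ic b.1) - r) (v (ic b.1) - r) - t b) ≤
      thetaT Q r v cls t y := by
    intro y
    have := le_ciSup (thetaT_bdd hR (r := r) hv cls t y) b.1
    rwa [h1] at this
  have heq : thetaT Q r v cls t x =
      dotp (ic b.1) x - ((1/2) * Q (v (ic b.1) - r) (v (ic b.1) - r) - t b) :=
    le_antisymm (ciSup_le fun a => hx a) (hle x)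
  rw [phi_eq hΛ hR hv hq b.1 x, heq]
  · ring
  · intro y
    have := hle y
    linarith

/-- Finitely many inequalities suffice, uniformly in `t` and `x`. -/
theorem finite_suffices {n : ℕ} {Λ : Set (Fin n → ℝ)} (hΛ : IsLattice Λ)
    {Q : (Fin n → ℝ) → (Fin n → ℝ) → ℝ} (hR : QRules Q) (hint : IntegralWrt Q Λ)
    {r : Fin n → ℝ}
    {v : (Fin n → ℝ) → (Fin n → ℝ)} (hv : ∀ a x, Q (v a) x = dotp a x)
    {B : Finset (Fin n → ℤ)} (cls : (Fin n → ℤ) → {b // b ∈ B})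
    (h1 : ∀ b : {b // b ∈ B}, cls b.1 = b)
    (h2 : ∀ a a', v (ic a) - v (ic a') ∈ Λ → cls a = cls a')
    (b : {b // b ∈ B}) :
    ∃ F : Finset (Fin n → ℤ), ∀ t x, (∀ a ∈ F, Good Q r v cls t b x a) →
      ∀ a, Good Q r v cls t b x a := by
  classical
  have hgood : ∀ t x a, Good Q r v cls t b x a ↔
      Q (v (ic a) - v (ic b.1)) (x - (v (ic b.1) - r)) ≤
        (1/2) * Q (v (ic a) - v (ic b.1)) (v (ic a) - v (ic b.1)) + t b - t (cls a) := by
    intro t x a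
    unfold Good
    rw [← hv, ← hv]
    simp only [hR.subl, hR.subr, hR.symm r (v (ic a)), hR.symm r (v (ic b.1)),
      hR.symm (v (ic b.1)) (v (ic a))]
    constructor <;> intro h <;> linarith
  obtain ⟨e, he⟩ := id hΛ
  have heΛ : ∀ i, e i ∈ Λ := by
    intro i
    rw [he]
    refine ⟨Pi.single i 1, ?_⟩
    rw [Finset.sum_eq_single i]
    · simp
    · intro j _ hj; simp [hj]
    · simp
  choose m hm using fun i => q_int hR hint hv (heΛ i)
  let D : (Fin n → ℝ) → ℝ := fun z => ∑ i, |e.repr z i| * ((1/2) * Q (e i) (e i))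
  let R : ℝ := ∑ j, D (v (Pi.single j 1)) * D (Pi.single j 1)
  let C : ℝ := (∑ d ∈ B, Q (v (ic d) - v (ic b.1)) (v (ic d) - v (ic b.1))) + R
  let F1 : Finset (Fin n → ℤ) := Finset.univ.image (fun i => b.1 + m i)
  let F2 : Finset (Fin n → ℤ) := Finset.univ.image (fun i => b.1 - m i)
  have hfin : {a : Fin n → ℤ | Q (v (ic a) - v (ic b.1)) (v (ic a) - v (ic b.1))
      ≤ 4 * (R + C)}.Finite := by
    have := (finite_small hR hv (4 * (R + C))).preimage
      (f := fun a => a - b.1) (sub_left_injective.injOn)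
    refine this.subset ?_
    intro a ha
    simp only [Set.mem_preimage, Set.mem_ofPred_eq, ic_sub, v_sub hR hv]
    exact ha
  refine ⟨F1 ∪ F2 ∪ B ∪ hfin.toFinset, ?_⟩
  intro t x hF a
  obtain ⟨y, hy⟩ : ∃ y, y = x - (v (ic b.1) - r) := ⟨_, rfl⟩
  simp only [hgood, ← hy] at hF ⊢
  have hbase : ∀ i, |Q (e i) y| ≤ (1/2) * Q (e i) (e i) := by
    intro i
    have ha1 : v (ic (b.1 + m i)) - v (ic b.1) = e i := by
      rw [← v_sub hR hv, ← ic_sub, add_sub_cancel_left, hm]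
    have ha2 : v (ic (b.1 - m i)) - v (ic b.1) = - e i := by
      rw [ic_sub, v_sub hR hv, hm]; abel
    have c1 : cls (b.1 + m i) = b := by
      rw [← h1 b]
      conv_lhs => rw [h1 b]
      apply h2; rw [ha1]; exact heΛ i
    have c2 : cls (b.1 - m i) = b := by
      rw [← h1 b]
      conv_lhs => rw [h1 b]
      apply h2; rw [ha2]; exact lat_neg hΛ (heΛ i)
    have g1 := hF (b.1 + m i) (by simp [F1])
    have g2 := hF (b.1 - m i) (by simp [F2])
    rw [ha1, c1] at g1
    rw [ha2, c2] at g2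
    simp only [hR.negl, hR.negr] at g2
    rw [abs_le]
    constructor <;> linarith
  have hD : ∀ z, |Q z y| ≤ D z := by
    intro z
    conv_lhs => rw [← e.sum_repr z]
    rw [hR.suml]
    refine (Finset.abs_sum_le_sum_abs _ _).trans (Finset.sum_le_sum fun i _ => ?_)
    rw [hR.smull, abs_mul]
    exact mul_le_mul_of_nonneg_left (hbase i) (abs_nonneg _)
  have hyR : Q y y ≤ R := by
    rw [hR.expand y y]
    refine Finset.sum_le_sum fun j _ => ?_
    have : y j = Q (v (Pi.single j 1)) y := by
      rw [hv]; simp [dotp, Pi.single_apply]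
    rw [this]
    refine (le_abs_self _).trans ?_
    rw [abs_mul]
    exact mul_le_mul (hD _) (hD _) (abs_nonneg _) ((abs_nonneg _).trans (hD _))
  have hosc : ∀ d : {b // b ∈ B}, t d - t b ≤ C := by
    intro d
    have g := hF d.1 (by simp [d.2])
    rw [h1] at g
    have h3 := hR.young (-(v (ic d.1) - v (ic b.1))) y
    simp only [hR.negl, hR.negr, neg_neg] at h3
    have h4 : Q (v (ic d.1) - v (ic b.1)) (v (ic d.1) - v (ic b.1)) ≤
        ∑ d ∈ B, Q (v (ic d) - v (ic b.1)) (v (ic d) - v (ic b.1)) :=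
      Finset.single_le_sum (f := fun d => Q (v (ic d) - v (ic b.1)) (v (ic d) - v (ic b.1)))
        (fun i _ => hR.nonneg _) d.2
    have h5 := hR.nonneg (v (ic d.1) - v (ic b.1))
    simp only [C]
    linarith
  by_cases ha : Q (v (ic a) - v (ic b.1)) (v (ic a) - v (ic b.1)) ≤ 4 * (R + C)
  · exact hF a (by
      simp only [Finset.mem_union]
      exact Or.inr (hfin.mem_toFinset.2 ha))
  · have h3 := hR.young (v (ic a) - v (ic b.1)) y
    have h4 := hosc (cls a)
    push Not at ha
    linarith

theorem stmt13 {n : ℕ} (Λ : Set (Fin n → ℝ)) (hΛ : IsLattice Λ)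
    (Q : (Fin n → ℝ) → (Fin n → ℝ) → ℝ) (hQ : IsSymmBilin Q)
    (hpos : ∀ x : Fin n → ℝ, x ≠ 0 → 0 < Q x x) (hint : IntegralWrt Q Λ)
    (r : Fin n → ℝ) (v : (Fin n → ℝ) → (Fin n → ℝ))
    (hv : ∀ a x, Q (v a) x = dotp a x)
    (B : Finset (Fin n → ℤ))
    (hB : ∀ m : Fin n → ℤ, ∃! b, b ∈ B ∧
      InQLat Λ Q (fun i => (m i : ℝ) - (b i : ℝ))) :
    ∃ (N : ℕ) (c : Fin N → (({b // b ∈ B} → ℝ) →ₗ[ℝ] ℝ)) (d : Fin N → ℝ),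
      thetaCoordSet Λ Q r v B = {t | ∀ i, d i ≤ c i t} := by
  have hR := mkQRules hQ hpos
  obtain ⟨cls, h1, h2, h3⟩ := exists_cls hΛ hR hv B hB
  choose F hF using fun b => finite_suffices hΛ hR hint (r := r) hv cls h1 h2 b
  have hpoly : IsPolyh {t : {b // b ∈ B} → ℝ | ∀ b, t ∈ {t : {b // b ∈ B} → ℝ |
      ∃ x, ∀ a : {a // a ∈ F b}, dotp (ic a.1 - ic b.1) x
        + ((1/2) * Q (v (ic b.1) - r) (v (ic b.1) - r)
          - (1/2) * Q (v (ic a.1) - r) (v (ic a.1) - r))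
        ≤ (LinearMap.proj (R := ℝ) (φ := fun _ => ℝ) b - LinearMap.proj (R := ℝ) (φ := fun _ => ℝ) (cls a.1) : ({b // b ∈ B} → ℝ) →ₗ[ℝ] ℝ) t}} :=
    IsPolyh.iInter (S := fun b : {b // b ∈ B} => {t : {b // b ∈ B} → ℝ |
      ∃ x, ∀ a : {a // a ∈ F b}, dotp (ic a.1 - ic b.1) x
        + ((1/2) * Q (v (ic b.1) - r) (v (ic b.1) - r)
          - (1/2) * Q (v (ic a.1) - r) (v (ic a.1) - r))
        ≤ (LinearMap.proj (R := ℝ) (φ := fun _ => ℝ) b - LinearMap.proj (R := ℝ) (φ := fun _ => ℝ) (cls a.1) : ({b // b ∈ B} → ℝ) →ₗ[ℝ] ℝ) t})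
      fun b => polyh_proj n (ι := {a // a ∈ F b})
        (fun a => (LinearMap.proj (R := ℝ) (φ := fun _ => ℝ) b - LinearMap.proj (R := ℝ) (φ := fun _ => ℝ) (cls a.1) : ({b // b ∈ B} → ℝ) →ₗ[ℝ] ℝ))
        (fun a => ic a.1 - ic b.1)
        (fun a => ((1/2) * Q (v (ic b.1) - r) (v (ic b.1) - r)
          - (1/2) * Q (v (ic a.1) - r) (v (ic a.1) - r)))
  have hS : thetaCoordSet Λ Q r v B = {t : {b // b ∈ B} → ℝ | ∀ b, t ∈ {t : {b // b ∈ B} → ℝ |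
      ∃ x, ∀ a : {a // a ∈ F b}, dotp (ic a.1 - ic b.1) x
        + ((1/2) * Q (v (ic b.1) - r) (v (ic b.1) - r)
          - (1/2) * Q (v (ic a.1) - r) (v (ic a.1) - r))
        ≤ (LinearMap.proj (R := ℝ) (φ := fun _ => ℝ) b - LinearMap.proj (R := ℝ) (φ := fun _ => ℝ) (cls a.1) : ({b // b ∈ B} → ℝ) →ₗ[ℝ] ℝ) t}} := by
    have hsub : ∀ a b x : Fin n → ℝ, dotp (a - b) x = dotp a x - dotp b x := by
      intro a b x
      simp [dotp, sub_mul]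
    ext t
    simp only [Set.mem_ofPred_eq, hsub, LinearMap.sub_apply, LinearMap.proj_apply]
    constructor
    · intro ht b
      obtain ⟨x, hx⟩ := good_of_mem hΛ hR hv cls h3 ht b
      refine ⟨x, fun a => ?_⟩
      have := hx a.1
      unfold Good at this
      linarith
    · intro h
      refine mem_of_good hΛ hR hint hv cls h1 h2 fun b => ?_
      obtain ⟨x, hx⟩ := h b
      refine ⟨x, hF b t x fun a ha => ?_⟩
      have := hx ⟨a, ha⟩
      unfold Good
      linarith
  rw [← hS] at hpoly
  obtain ⟨ι, hι, c, d, h⟩ := hpoly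
  refine ⟨Fintype.card ι, fun i => c ((Fintype.equivFin ι).symm i),
    fun i => d ((Fintype.equivFin ι).symm i), ?_⟩
  rw [h]
  ext t
  simp only [Set.mem_ofPred_eq]
  exact ⟨fun h i => h _, fun h i => by simpa using h (Fintype.equivFin ι i)⟩
end
end

section
/- Let Λ be a lattice in ℝ^n, let Q be a positive definite symmetric bilinear form on ℝ^n that is integral with respect to Λ, fix r ∈ ℝ^n, and let B = {b_1, …, b_l} ⊂ ℤ^n be a complete set of representatives of ℤ^n/q(Λ) with l = |B| ≥ 2. For any points q_1, …, q_{l−1} ∈ ℝ^n, define the tropical Vandermonde function V(x) = max_{σ∈S_l} ( Θ_{b_{σ(1)}}(x) + Σ_{i=2}^{l} Θ_{b_{σ(i)}}(q_{i−1}) ), where S_l is the symmetric group on {1,…,l}. Then V is a theta function for (Q, Q(·,r)), and for each k ∈ {1,…,l−1}, V is not affine on any neighborhood of q_k. -/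
noncomputable section

/-- Evaluation of the integral affine function with data `p`. -/
def evA {n : ℕ} (p : (Fin n → ℤ) × ℝ) (y : Fin n → ℝ) : ℝ :=
  dotp (fun j => (p.1 j : ℝ)) y + p.2

/-- `Θ` is locally the attained maximum of finitely many members of the family `P`. -/
def ReprBy {n : ℕ} (Θ : (Fin n → ℝ) → ℝ) (P : Set ((Fin n → ℤ) × ℝ)) : Prop :=
  ∀ x : Fin n → ℝ, ∃ U ∈ nhds x, ∃ F : Finset ((Fin n → ℤ) × ℝ), (↑F ⊆ P) ∧
    ∀ y ∈ U, (∀ p ∈ P, evA p y ≤ Θ y) ∧ ∃ p ∈ F, evA p y = Θ y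

lemma dotp_add {n : ℕ} (a x y : Fin n → ℝ) : dotp a (x + y) = dotp a x + dotp a y := by
  simp [dotp, mul_add, Finset.sum_add_distrib]

lemma dotp_smul {n : ℕ} (a x : Fin n → ℝ) (t : ℝ) : dotp a (t • x) = t * dotp a x := by
  simp only [dotp, Finset.mul_sum, Pi.smul_apply, smul_eq_mul]
  exact Finset.sum_congr rfl (fun i _ => by ring)

lemma ReprBy.convex {n : ℕ} {Θ : (Fin n → ℝ) → ℝ} {P} (h : ReprBy Θ P) :
    ConvexOn ℝ Set.univ Θ := by
  refine ⟨convex_univ, ?_⟩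
  intro x _ y _ s t hs ht hst
  have le : ∀ z, ∀ p ∈ P, evA p z ≤ Θ z := by
    intro z
    obtain ⟨U, hU, F, hF, hy⟩ := h z
    exact (hy z (mem_of_mem_nhds hU)).1
  obtain ⟨U, hU, F, hF, hy⟩ := h (s • x + t • y)
  obtain ⟨p, hp, hpe⟩ := (hy _ (mem_of_mem_nhds hU)).2
  rw [← hpe]
  have h1 := mul_le_mul_of_nonneg_left (le x p (hF hp)) hs
  have h2 := mul_le_mul_of_nonneg_left (le y p (hF hp)) ht
  have h3 : evA p (s • x + t • y) = s * evA p x + t * evA p y := by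
    simp only [evA, dotp_add, dotp_smul]
    linear_combination (-p.2) * hst
  simp only [smul_eq_mul]
  linarith

lemma ReprBy.regular {n : ℕ} {Θ : (Fin n → ℝ) → ℝ} {P} (h : ReprBy Θ P) :
    RegularFn Θ := by
  intro x
  obtain ⟨U, hU, F, hF, hy⟩ := h x
  obtain ⟨p0, hp0, -⟩ := (hy x (mem_of_mem_nhds hU)).2
  obtain ⟨k, hk⟩ : ∃ k, F.card = k + 1 :=
    Nat.exists_eq_succ_of_ne_zero (Finset.card_ne_zero_of_mem hp0)
  let e := F.equivFinOfCardEq hk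
  refine ⟨U, hU, k, fun i => (e.symm i).1.1, fun i => (e.symm i).1.2, ?_⟩
  intro y hyU
  obtain ⟨h1, p, hp, hpe⟩ := hy y hyU
  apply le_antisymm
  · rw [← hpe]
    refine le_trans (le_of_eq ?_) (Finset.le_sup' _ (Finset.mem_univ (e ⟨p, hp⟩)))
    simp [evA]
  · apply Finset.sup'_le
    intro i _
    exact h1 (e.symm i).1 (hF (e.symm i).2)

lemma slope_eq {n : ℕ} (a a' x : Fin n → ℝ) (c c' : ℝ) (U : Set (Fin n → ℝ))
    (hU : U ∈ nhds x) (hle : ∀ y ∈ U, dotp a y + c ≤ dotp a' y + c')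
    (heq : dotp a x + c = dotp a' x + c') : a = a' := by
  have hcont : Filter.Tendsto (fun t : ℝ => x + t • (a - a')) (nhds 0) (nhds x) := by
    have : Continuous (fun t : ℝ => x + t • (a - a')) := by fun_prop
    simpa using this.tendsto 0
  have h1 : ∀ᶠ t : ℝ in nhdsWithin 0 (Set.Ioi 0), x + t • (a - a') ∈ U :=
    (hcont.eventually hU).filter_mono nhdsWithin_le_nhds
  obtain ⟨t, htU, ht⟩ := (h1.and self_mem_nhdsWithin).exists
  have ht : 0 < t := ht
  have h2 := hle _ htU
  rw [dotp_add, dotp_add, dotp_smul, dotp_smul] at h2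
  have h3 : t * (dotp a (a - a') - dotp a' (a - a')) ≤ 0 := by linarith
  have h4 : dotp a (a - a') - dotp a' (a - a') ≤ 0 := by
    by_contra hc
    have := mul_pos ht (not_le.mp hc)
    linarith
  have h5 : dotp a (a - a') - dotp a' (a - a') = ∑ i, (a i - a' i) ^ 2 := by
    simp only [dotp, ← Finset.sum_sub_distrib, Pi.sub_apply]
    exact Finset.sum_congr rfl (fun i _ => by ring)
  rw [h5] at h4
  have h6 := (Finset.sum_eq_zero_iff_of_nonneg (fun i _ => sq_nonneg (a i - a' i))).1
    (le_antisymm h4 (Finset.sum_nonneg (fun i _ => sq_nonneg (a i - a' i))))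
  funext i
  have := h6 i (Finset.mem_univ i)
  have := pow_eq_zero_iff (two_ne_zero) |>.1 this
  linarith

/-- A touching affine majorant has slope in the family. -/
lemma ReprBy.slope {n : ℕ} {Θ : (Fin n → ℝ) → ℝ} {P} (h : ReprBy Θ P)
    (a x : Fin n → ℝ) (c : ℝ) (U : Set (Fin n → ℝ)) (hU : U ∈ nhds x)
    (hle : ∀ y ∈ U, Θ y ≤ dotp a y + c) (heq : Θ x = dotp a x + c) :
    ∃ p ∈ P, (fun j => (p.1 j : ℝ)) = a := by
  obtain ⟨W, hW, F, hF, hy⟩ := h x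
  obtain ⟨h1, p, hp, hpe⟩ := hy x (mem_of_mem_nhds hW)
  refine ⟨p, hF hp, slope_eq _ a x p.2 c (U ∩ W) (Filter.inter_mem hU hW) ?_ ?_⟩
  · intro y hyU
    exact ((hy y hyU.2).1 p (hF hp)).trans (hle y hyU.1)
  · exact hpe.trans heq

lemma ReprBy.max {n : ℕ} {ι : Type} [Fintype ι] [Nonempty ι]
    {Θ : ι → (Fin n → ℝ) → ℝ} {P : ι → Set ((Fin n → ℤ) × ℝ)} (h : ∀ i, ReprBy (Θ i) (P i))
    (c : ι → ℝ) :
    ReprBy (fun x => Finset.univ.sup' Finset.univ_nonempty (fun i => Θ i x + c i))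
      {p | ∃ i, (p.1, p.2 - c i) ∈ P i} := by
  classical
  intro x
  choose U hU F hF hy using fun i => h i x
  refine ⟨⋂ i, U i, (Filter.iInter_mem).2 hU,
    Finset.univ.biUnion (fun i => (F i).image (fun p => (p.1, p.2 + c i))), ?_, ?_⟩
  · intro p hp
    simp only [Finset.coe_biUnion, Set.mem_iUnion, Finset.coe_image, Set.mem_image] at hp
    obtain ⟨i, _, p', hp', rfl⟩ := hp
    exact ⟨i, by simpa using hF i hp'⟩
  · intro y hyU
    have hyU' := Set.mem_iInter.1 hyU
    constructor
    · rintro p ⟨i, hi⟩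
      have h1 := (hy i y (hyU' i)).1 _ hi
      refine le_trans ?_ (Finset.le_sup' _ (Finset.mem_univ i))
      simp only [evA] at h1 ⊢
      linarith
    · obtain ⟨i, _, hi⟩ := Finset.exists_mem_eq_sup' (Finset.univ_nonempty (α := ι))
        (fun i => Θ i y + c i)
      obtain ⟨_, p, hp, hpe⟩ := hy i y (hyU' i)
      refine ⟨(p.1, p.2 + c i), ?_, ?_⟩
      · simp only [Finset.mem_biUnion, Finset.mem_image, Finset.mem_univ, true_and]
        exact ⟨i, p, hp, rfl⟩
      · simp only [hi, ← hpe, evA]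
        ring

/-- The family of affine functions whose sup is the generator. -/
def famOf {n : ℕ} (Λ : Set (Fin n → ℝ)) (Q : (Fin n → ℝ) → (Fin n → ℝ) → ℝ)
    (r vb : Fin n → ℝ) (b : Fin n → ℤ) : Set ((Fin n → ℤ) × ℝ) :=
  {p | ∃ l ∈ Λ, (∀ x, dotp (fun j => (p.1 j : ℝ)) x = dotp (fun i => (b i : ℝ)) x + Q l x) ∧
    p.2 = - ((1/2) * Q (l + vb - r) (l + vb - r))}

section
variable {n : ℕ} {Λ : Set (Fin n → ℝ)} {Q : (Fin n → ℝ) → (Fin n → ℝ) → ℝ}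

lemma Q_addr (hQ : IsSymmBilin Q) (x y z) : Q x (y + z) = Q x y + Q x z := (hQ.1 x).map_add y z
lemma Q_addl (hQ : IsSymmBilin Q) (x y z) : Q (x + y) z = Q x z + Q y z := by
  rw [hQ.2, Q_addr hQ, hQ.2 z x, hQ.2 z y]
lemma Q_smulr (hQ : IsSymmBilin Q) (t : ℝ) (x y) : Q x (t • y) = t * Q x y := (hQ.1 x).map_smul t y
lemma Q_smull (hQ : IsSymmBilin Q) (t : ℝ) (x y) : Q (t • x) y = t * Q x y := by
  rw [hQ.2, Q_smulr hQ, hQ.2]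
lemma Q_negr (hQ : IsSymmBilin Q) (x y) : Q x (-y) = - Q x y := (hQ.1 x).map_neg y
lemma Q_negl (hQ : IsSymmBilin Q) (x y) : Q (-x) y = - Q x y := by
  rw [hQ.2, Q_negr hQ, hQ.2]
lemma Q_subr (hQ : IsSymmBilin Q) (x y z) : Q x (y - z) = Q x y - Q x z := (hQ.1 x).map_sub y z
lemma Q_subl (hQ : IsSymmBilin Q) (x y z) : Q (x - y) z = Q x z - Q y z := by
  rw [hQ.2, Q_subr hQ, hQ.2 z x, hQ.2 z y]

lemma Q_nonneg (hQ : IsSymmBilin Q) (hpos : ∀ x : Fin n → ℝ, x ≠ 0 → 0 < Q x x) (x) :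
    0 ≤ Q x x := by
  by_cases h : x = 0
  · subst h
    rw [(hQ.1 0).map_zero]
  · exact (hpos x h).le

lemma Q_cs (hQ : IsSymmBilin Q) (hpos : ∀ x : Fin n → ℝ, x ≠ 0 → 0 < Q x x) (u y) :
    Q u y ≤ (1/4) * Q u u + Q y y := by
  have h := Q_nonneg hQ hpos ((1/2 : ℝ) • u - y)
  rw [Q_subr hQ, Q_subl hQ, Q_subl hQ, Q_smulr hQ, Q_smulr hQ, Q_smull hQ, Q_smull hQ,
    hQ.2 y u] at h
  linarith

lemma Q_cont (hQ : IsSymmBilin Q) : Continuous (fun y => Q y y) := by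
  have h : ∀ y, Q y y = ∑ i, y i * Q (Pi.single i 1) y := by
    intro y
    let L : (Fin n → ℝ) →ₗ[ℝ] ℝ := IsLinearMap.mk' (Q y) (hQ.1 y)
    have : L y = ∑ i, y i • L (Pi.single i 1) := by
      conv_lhs => rw [pi_eq_sum_univ' y]
      rw [map_sum]
      refine Finset.sum_congr rfl (fun i _ => ?_)
      rw [map_smul]
    calc Q y y = L y := rfl
      _ = _ := this
      _ = _ := Finset.sum_congr rfl (fun i _ => by
        show y i * Q y _ = _
        rw [hQ.2 y])
  simp only [h]
  refine continuous_finset_sum _ (fun i _ => (continuous_apply i).mul ?_)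
  exact (IsLinearMap.mk' _ (hQ.1 (Pi.single i 1))).continuous_of_finiteDimensional

lemma Q_bdd (hQ : IsSymmBilin Q) (hpos : ∀ x : Fin n → ℝ, x ≠ 0 → 0 < Q x x)
    (v : (Fin n → ℝ) → (Fin n → ℝ)) (hv : ∀ a x, Q (v a) x = dotp a x) (w : Fin n → ℝ) (R : ℝ) :
    Bornology.IsBounded {l | Q (l + w) (l + w) ≤ R} := by
  rw [← Bornology.forall_isBounded_image_eval_iff]
  intro i
  rw [isBounded_iff_bddBelow_bddAbove]
  set s : Fin n → ℝ := v (Pi.single i 1)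
  have hs : ∀ u, Q u s = u i := by
    intro u
    rw [hQ.2, hv]
    simp [dotp, Pi.single_apply]
  constructor
  · refine ⟨-((1/4) * R + Q s s) - w i, ?_⟩
    rintro _ ⟨l, hl, rfl⟩
    have h := Q_cs hQ hpos (-(l + w)) s
    rw [Q_negl hQ, hs, Q_negl hQ, Q_negr hQ, neg_neg] at h
    have hl : Q (l + w) (l + w) ≤ R := hl
    simp only [Pi.add_apply] at h
    simp only [Function.eval]
    linarith
  · refine ⟨((1/4) * R + Q s s) - w i, ?_⟩
    rintro _ ⟨l, hl, rfl⟩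
    have h := Q_cs hQ hpos (l + w) s
    rw [hs] at h
    have hl : Q (l + w) (l + w) ≤ R := hl
    simp only [Pi.add_apply] at h
    simp only [Function.eval]
    linarith

lemma lat_span (e : Module.Basis (Fin n) ℝ (Fin n → ℝ)) :
    {x | ∃ c : Fin n → ℤ, x = ∑ i, (c i : ℝ) • e i} =
      (Submodule.span ℤ (Set.range e) : Set (Fin n → ℝ)) := by
  ext x
  simp only [Set.mem_setOf_eq, SetLike.mem_coe, Submodule.mem_span_range_iff_exists_fun]
  constructor
  · rintro ⟨c, rfl⟩
    exact ⟨c, by simp [← Int.cast_smul_eq_zsmul ℝ]⟩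
  · rintro ⟨c, rfl⟩
    exact ⟨c, by simp [← Int.cast_smul_eq_zsmul ℝ]⟩

lemma slope_exists (hQ : IsSymmBilin Q) (hint : IntegralWrt Q Λ) (b : Fin n → ℤ)
    (l) (hl : l ∈ Λ) : ∃ a : Fin n → ℤ, ∀ x, dotp (fun j => (a j : ℝ)) x
      = dotp (fun i => (b i : ℝ)) x + Q l x := by
  choose k hk using fun i : Fin n => hint l hl (Pi.single i 1)
  refine ⟨fun i => b i + k i, fun x => ?_⟩
  have h : Q l x = ∑ i, x i * Q l (Pi.single i 1) := by
    let L : (Fin n → ℝ) →ₗ[ℝ] ℝ := IsLinearMap.mk' (Q l) (hQ.1 l)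
    have : L x = ∑ i, x i • L (Pi.single i 1) := by
      conv_lhs => rw [pi_eq_sum_univ' x]
      rw [map_sum]
      exact Finset.sum_congr rfl (fun i _ => by rw [map_smul])
    exact this
  have hk' : ∀ i, Q l (Pi.single i 1) = k i := by
    intro i
    rw [← hk i]
    congr 1
    funext j
    by_cases hij : j = i
    · subst hij; simp
    · simp [hij]
  rw [h]
  simp only [dotp, hk', ← Finset.sum_add_distrib]
  refine Finset.sum_congr rfl (fun i _ => ?_)
  push_cast
  ring

lemma gen_repr (hΛ : IsLattice Λ) (hQ : IsSymmBilin Q)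
    (hpos : ∀ x : Fin n → ℝ, x ≠ 0 → 0 < Q x x) (hint : IntegralWrt Q Λ)
    (r : Fin n → ℝ) (v : (Fin n → ℝ) → (Fin n → ℝ))
    (hv : ∀ a x, Q (v a) x = dotp a x) (b : Fin n → ℤ) :
    ReprBy (thetaGenOf Λ Q r v b) (famOf Λ Q r (v (fun i => (b i : ℝ))) b) := by
  classical
  intro x
  set vb := v (fun i => (b i : ℝ)) with hvb
  set w := vb - r with hw
  have h0 : (0 : Fin n → ℝ) ∈ Λ := by
    obtain ⟨e, rfl⟩ := hΛ
    exact ⟨0, by simp⟩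
  set R := 8 * (Q x x + 1) + 3 * Q w w with hR
  have hfin : ({l | Q (l + w) (l + w) ≤ R} ∩ Λ).Finite := by
    obtain ⟨e, rfl⟩ := hΛ
    rw [lat_span]
    exact ZSpan.setFinite_inter e (Q_bdd hQ hpos v hv w R)
  choose! A hA using fun l (hl : l ∈ Λ) => slope_exists hQ hint b l hl
  let G : Finset (Fin n → ℝ) := insert 0 hfin.toFinset
  have hG : ∀ l ∈ G, l ∈ Λ := by
    intro l hl
    rcases Finset.mem_insert.1 hl with rfl | hl
    · exact h0
    · exact ((hfin.mem_toFinset).1 hl).2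
  let f : (Fin n → ℝ) → (Fin n → ℝ) → ℝ := fun l y => dotp (fun i => (b i : ℝ)) y + Q l y
      - (1/2) * Q (l + vb - r) (l + vb - r)
  let p : (Fin n → ℝ) → (Fin n → ℤ) × ℝ := fun l =>
    (A l, - ((1/2) * Q (l + vb - r) (l + vb - r)))
  have hpf : ∀ l ∈ Λ, ∀ y, evA (p l) y = f l y := by
    intro l hl y
    simp only [evA, p, f, hA l hl]
    ring
  have hU : {y | Q y y < Q x x + 1} ∈ nhds x :=
    (isOpen_lt (Q_cont hQ) continuous_const).mem_nhds (by simp)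
  refine ⟨_, hU, G.image p, ?_, ?_⟩
  · intro a ha
    obtain ⟨l, hl, rfl⟩ := Finset.mem_image.1 (Finset.mem_coe.1 ha)
    exact ⟨l, hG l hl, hA l (hG l hl), rfl⟩
  · intro y hy
    have hy : Q y y < Q x x + 1 := hy
    have hdom : ∀ l ∈ Λ, ∃ m ∈ G, f l y ≤ f m y := by
      intro l hl
      by_cases hlR : Q (l + w) (l + w) ≤ R
      · exact ⟨l, Finset.mem_insert_of_mem ((hfin.mem_toFinset).2 ⟨hlR, hl⟩), le_rfl⟩
      · refine ⟨0, Finset.mem_insert_self _ _, ?_⟩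
        have e1 : ∀ m, f m y = dotp (fun i => (b i : ℝ)) y - Q w y + (Q (m + w) y
            - (1/2) * Q (m + w) (m + w)) := by
          intro m
          simp only [f, add_sub_assoc, ← hw, Q_addl hQ m w y]
          ring
        rw [e1, e1, zero_add]
        have h1 := Q_cs hQ hpos (l + w) y
        have h2 := Q_cs hQ hpos (-w) y
        rw [Q_negl hQ, Q_negl hQ, Q_negr hQ, neg_neg] at h2
        push Not at hlR
        linarith
    obtain ⟨m, hm, hmax⟩ := Finset.exists_max_image G (fun m => f m y)
      ⟨0, Finset.mem_insert_self _ _⟩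
    have hgr : IsGreatest {t | ∃ l ∈ Λ, t = f l y} (f m y) := by
      refine ⟨⟨m, hG m hm, rfl⟩, ?_⟩
      rintro _ ⟨l, hl, rfl⟩
      obtain ⟨m', hm', h⟩ := hdom l hl
      exact h.trans (hmax m' hm')
    have hval : thetaGenOf Λ Q r v b y = f m y := hgr.csSup_eq
    rw [hval]
    constructor
    · rintro ⟨a, c⟩ ⟨l, hl, ha, hc⟩
      have : evA (a, c) y = f l y := by
        simp only [evA, f] at ha hc ⊢
        rw [ha y, hc]
        ring
      rw [this]
      exact hgr.2 ⟨l, hl, rfl⟩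
    · exact ⟨p m, Finset.mem_image_of_mem _ hm, hpf m (hG m hm) y⟩

lemma gen_quasi (hΛ : IsLattice Λ) (hQ : IsSymmBilin Q)
    (r : Fin n → ℝ) (v : (Fin n → ℝ) → (Fin n → ℝ))
    (hv : ∀ a x, Q (v a) x = dotp a x) (b : Fin n → ℤ)
    (hrp : ReprBy (thetaGenOf Λ Q r v b) (famOf Λ Q r (v (fun i => (b i : ℝ))) b))
    (hint : IntegralWrt Q Λ) :
    QuasiPeriodic Λ Q (fun x => Q x r) (thetaGenOf Λ Q r v b) := by
  set vb := v (fun i => (b i : ℝ)) with hvb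
  have hneg : ∀ l ∈ Λ, -l ∈ Λ := by
    obtain ⟨e, rfl⟩ := hΛ
    rw [lat_span]
    intro l hl
    exact neg_mem (S := Submodule ℤ (Fin n → ℝ)) hl
  have hadd : ∀ l ∈ Λ, ∀ m ∈ Λ, l + m ∈ Λ := by
    obtain ⟨e, rfl⟩ := hΛ
    rw [lat_span]
    intro l hl m hm
    exact add_mem (S := Submodule ℤ (Fin n → ℝ)) hl hm
  -- one inequality suffices
  have key : ∀ l ∈ Λ, ∀ x, thetaGenOf Λ Q r v b x + Q l x + (1/2) * Q l l + Q l r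
      ≤ thetaGenOf Λ Q r v b (x + l) := by
    intro l hl x
    obtain ⟨U, hU, F, hF, hy⟩ := hrp x
    obtain ⟨-, p, hp, hpe⟩ := hy x (mem_of_mem_nhds hU)
    obtain ⟨m, hm, ha, hc⟩ := hF hp
    obtain ⟨U', hU', F', hF', hy'⟩ := hrp (x + l)
    have hle := (hy' _ (mem_of_mem_nhds hU')).1
    obtain ⟨A, hA⟩ := slope_exists hQ hint b (m + l) (hadd m hm l hl)
    have h1 := hle (A, - ((1/2) * Q (m + l + vb - r) (m + l + vb - r)))
      ⟨m + l, hadd m hm l hl, hA, rfl⟩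
    refine le_trans (le_of_eq ?_) h1
    rw [← hpe]
    simp only [evA, hA, ha, hc]
    rw [← hv, ← hv]
    simp only [← hvb, Q_addl hQ, Q_addr hQ, Q_subl hQ, Q_subr hQ]
    rw [hQ.2 l m, hQ.2 r l, hQ.2 r m, hQ.2 r vb, hQ.2 l vb, hQ.2 m vb]
    ring
  intro l hl x
  apply le_antisymm
  · have h := key (-l) (hneg l hl) (x + l)
    rw [add_neg_cancel_right] at h
    simp only [Q_negl hQ, Q_negr hQ, Q_addr hQ] at h
    linarith
  · exact key l hl x

end

theorem stmt18 {n l : ℕ} (Λ : Set (Fin n → ℝ)) (hΛ : IsLattice Λ)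
    (Q : (Fin n → ℝ) → (Fin n → ℝ) → ℝ) (hQ : IsSymmBilin Q)
    (hpos : ∀ x : Fin n → ℝ, x ≠ 0 → 0 < Q x x) (hint : IntegralWrt Q Λ)
    (r : Fin n → ℝ) (v : (Fin n → ℝ) → (Fin n → ℝ))
    (hv : ∀ a x, Q (v a) x = dotp a x)
    (b : Fin (l + 2) → (Fin n → ℤ))
    (hrep : ∀ m : Fin n → ℤ, ∃! i : Fin (l + 2),
      InQLat Λ Q (fun j => (m j : ℝ) - (b i j : ℝ)))
    (q : Fin (l + 1) → (Fin n → ℝ)) :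
    IsThetaFn Λ Q (fun x => Q x r)
      (fun x => Finset.univ.sup' Finset.univ_nonempty
        (fun σ : Equiv.Perm (Fin (l + 2)) =>
          thetaGenOf Λ Q r v (b (σ 0)) x
            + ∑ i : Fin (l + 1), thetaGenOf Λ Q r v (b (σ i.succ)) (q i))) ∧
    ∀ k : Fin (l + 1), ¬ ∃ U ∈ nhds (q k), ∃ (a : Fin n → ℝ) (c : ℝ),
      ∀ y ∈ U, (Finset.univ.sup' Finset.univ_nonempty
        (fun σ : Equiv.Perm (Fin (l + 2)) =>
          thetaGenOf Λ Q r v (b (σ 0)) y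
            + ∑ i : Fin (l + 1), thetaGenOf Λ Q r v (b (σ i.succ)) (q i)))
        = dotp a y + c := by
  have hrp := fun i => gen_repr hΛ hQ hpos hint r v hv (b i)
  have hqp := fun i => gen_quasi hΛ hQ r v hv (b i) (hrp i) hint
  have hV := ReprBy.max (ι := Equiv.Perm (Fin (l + 2))) (fun σ => hrp (σ 0))
    (fun σ => ∑ i : Fin (l + 1), thetaGenOf Λ Q r v (b (σ i.succ)) (q i))
  refine ⟨⟨hV.convex, hV.regular, ?_⟩, ?_⟩
  · intro m hm x
    apply le_antisymm
    · apply Finset.sup'_le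
      intro σ _
      rw [hqp (σ 0) m hm x]
      have := Finset.le_sup' (fun σ : Equiv.Perm (Fin (l + 2)) =>
          thetaGenOf Λ Q r v (b (σ 0)) x
            + ∑ i : Fin (l + 1), thetaGenOf Λ Q r v (b (σ i.succ)) (q i)) (Finset.mem_univ σ)
      linarith
    · obtain ⟨σ, _, hσ⟩ := Finset.exists_mem_eq_sup' Finset.univ_nonempty
        (fun σ : Equiv.Perm (Fin (l + 2)) =>
          thetaGenOf Λ Q r v (b (σ 0)) x
            + ∑ i : Fin (l + 1), thetaGenOf Λ Q r v (b (σ i.succ)) (q i))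
      have := Finset.le_sup' (fun σ : Equiv.Perm (Fin (l + 2)) =>
          thetaGenOf Λ Q r v (b (σ 0)) (x + m)
            + ∑ i : Fin (l + 1), thetaGenOf Λ Q r v (b (σ i.succ)) (q i)) (Finset.mem_univ σ)
      simp only [hqp (σ 0) m hm x] at this
      simp only [hσ]
      linarith
  · rintro k ⟨U, hU, a, c, hy⟩
    obtain ⟨σ, _, hσ⟩ := Finset.exists_mem_eq_sup' Finset.univ_nonempty
        (fun σ : Equiv.Perm (Fin (l + 2)) =>
          thetaGenOf Λ Q r v (b (σ 0)) (q k)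
            + ∑ i : Fin (l + 1), thetaGenOf Λ Q r v (b (σ i.succ)) (q i))
    -- any permutation attaining the max gives a slope
    have main : ∀ τ : Equiv.Perm (Fin (l + 2)),
        thetaGenOf Λ Q r v (b (τ 0)) (q k)
            + ∑ i : Fin (l + 1), thetaGenOf Λ Q r v (b (τ i.succ)) (q i) = dotp a (q k) + c →
        ∃ m : Fin n → ℤ, (fun j => (m j : ℝ)) = a ∧
          InQLat Λ Q (fun j => (m j : ℝ) - (b (τ 0) j : ℝ)) := by
      intro τ hτ
      obtain ⟨p, ⟨m, hm, hp, -⟩, hpa⟩ := (hrp (τ 0)).slope a (q k)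
        (c - ∑ i : Fin (l + 1), thetaGenOf Λ Q r v (b (τ i.succ)) (q i)) U hU (by
          intro y hyU
          have h1 := hy y hyU
          have := Finset.le_sup' (fun σ : Equiv.Perm (Fin (l + 2)) =>
            thetaGenOf Λ Q r v (b (σ 0)) y
              + ∑ i : Fin (l + 1), thetaGenOf Λ Q r v (b (σ i.succ)) (q i)) (Finset.mem_univ τ)
          simp only [h1] at this
          linarith) (by linarith)
      refine ⟨p.1, hpa, m, hm, fun x => ?_⟩
      have h := hp x
      have e : dotp (fun j => (p.1 j : ℝ) - (b (τ 0) j : ℝ)) x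
          = dotp (fun j => (p.1 j : ℝ)) x - dotp (fun j => (b (τ 0) j : ℝ)) x := by
        simp [dotp, sub_mul, Finset.sum_sub_distrib]
      rw [e, h]
      ring
    have hσ' := hσ.symm.trans (hy _ (mem_of_mem_nhds hU))
    obtain ⟨m₁, hm₁, hq₁⟩ := main σ hσ'
    have hsum : ∀ τ : Equiv.Perm (Fin (l + 2)), thetaGenOf Λ Q r v (b (τ 0)) (q k)
            + ∑ i : Fin (l + 1), thetaGenOf Λ Q r v (b (τ i.succ)) (q i)
        = ∑ i : Fin (l + 2), thetaGenOf Λ Q r v (b (τ i)) (Fin.cons (α := fun _ => Fin n → ℝ)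
            (q k) q i) := by
      intro τ
      exact ((Fin.sum_univ_succ _).trans (by simp only [Fin.cons_zero, Fin.cons_succ])).symm
    obtain ⟨m₂, hm₂, hq₂⟩ := main (Equiv.swap 0 k.succ * σ.symm).symm (by
      rw [← hσ', hsum, hsum]
      have hs : ∀ i, (Equiv.swap 0 k.succ * σ.symm).symm i = σ (Equiv.swap 0 k.succ i) := by
        intro i
        rw [Equiv.symm_apply_eq]
        simp
      simp only [hs]
      rw [← Equiv.sum_comp (Equiv.swap (0 : Fin (l + 2)) k.succ)]
      refine Finset.sum_congr rfl (fun i _ => ?_)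
      rw [Equiv.swap_apply_self]
      congr 1
      by_cases h0 : i = 0
      · subst h0; simp
      · by_cases hk : i = k.succ
        · subst hk; simp
        · rw [Equiv.swap_apply_of_ne_of_ne h0 hk])
    have hmm : m₁ = m₂ := by
      funext j
      have := congrFun (hm₁.trans hm₂.symm) j
      exact_mod_cast this
    subst hmm
    have hτ0 : (Equiv.swap 0 k.succ * σ.symm).symm 0 = σ k.succ := by
      rw [Equiv.symm_apply_eq]
      simp
    rw [hτ0] at hq₂
    have := (hrep m₁).unique hq₁ hq₂
    exact (Fin.succ_ne_zero k) (σ.injective this).symm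
end
end
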